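/- (Gallai–Edmonds Structure Theorem) Let G = (V,E) be a finite graph with Gallai–Edmonds decomposition GE(G) = (C,A,D). Then: (1) every connected component of G[D] is factor-critical; (2) every maximum matching of G contains a perfect matching of G[C], contains a near-perfect matching of each connected component of G[D], and matches every vertex of A to vertices lying in pairwise distinct components of G[D]; (3) |V| − 2ν(G) = k(D) − |A|, where k(D) is the number of connected components of G[D]. -/

import Mathlib

open SimpleGraph

variable {V : Type*}

/-- `M` is a set of edges of `G` forming a matching (pairwise disjoint edges). -/
def IsMatchingSet (G : SimpleGraph V) (M : Finset (Sym2 V)) : Prop :=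
  (∀ e ∈ M, e ∈ G.edgeSet) ∧
    ∀ e ∈ M, ∀ f ∈ M, e ≠ f → ∀ v : V, v ∈ e → v ∉ f

/-- The matching number `ν(G)`. -/
noncomputable def matchingNumber (G : SimpleGraph V) : ℕ :=
  sSup {n | ∃ M : Finset (Sym2 V), IsMatchingSet G M ∧ M.card = n}

/-- `ν_G(X,Y)`: the maximum size of a matching of `G` each edge of which has one
endpoint in `X` and one endpoint in `Y`. -/
noncomputable def nuBetween (G : SimpleGraph V) (X Y : Set V) : ℕ :=
  sSup {n | ∃ M : Finset (Sym2 V), IsMatchingSet G M ∧ M.card = n ∧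
    ∀ e ∈ M, ∃ x ∈ X, ∃ y ∈ Y, e = s(x, y)}

/-- The set `D` of the Gallai–Edmonds decomposition: the inessential vertices,
i.e. those missed by some maximum matching. -/
def geD (G : SimpleGraph V) : Set V :=
  {v | ∃ M : Finset (Sym2 V), IsMatchingSet G M ∧ M.card = matchingNumber G ∧ ∀ e ∈ M, v ∉ e}

/-- The set `A` of the Gallai–Edmonds decomposition: vertices outside `D` with a
neighbour in `D`. -/
def geA (G : SimpleGraph V) : Set V :=
  {v | v ∉ geD G ∧ ∃ u ∈ geD G, G.Adj v u}

/-- The set `C` of the Gallai–Edmonds decomposition: the remaining vertices. -/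
def geC (G : SimpleGraph V) : Set V :=
  {v | v ∉ geD G ∧ v ∉ geA G}

/-- `G` is an `s`-connector: any two disjoint vertex sets of size at least `s`
are joined by an edge. -/
def IsConnector (G : SimpleGraph V) (s : ℕ) : Prop :=
  ∀ X Y : Set V, Disjoint X Y → s ≤ X.ncard → s ≤ Y.ncard →
    ∃ x ∈ X, ∃ y ∈ Y, G.Adj x y

/-- `G → (t₁K₂, …, t_qK₂)`: every `q`-colouring of the edges of `G` admits a colour
`j` and a `j`-monochromatic matching of size `t j`. -/
def ArrowsMatch (G : SimpleGraph V) {q : ℕ} (t : Fin q → ℕ) : Prop :=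
  ∀ c : Sym2 V → Fin q, ∃ j : Fin q, ∃ M : Finset (Sym2 V),
    IsMatchingSet G M ∧ M.card = t j ∧ ∀ e ∈ M, c e = j

/-- The induced subgraph `G[S]`, viewed as a graph on the same vertex set. -/
def inducedOn (G : SimpleGraph V) (S : Set V) : SimpleGraph V where
  Adj a b := G.Adj a b ∧ a ∈ S ∧ b ∈ S
  symm := ⟨fun _ _ ⟨h, ha, hb⟩ => ⟨h.symm, hb, ha⟩⟩
  loopless := ⟨fun a h => G.loopless.irrefl a h.1⟩

/-- Remove from `G` every edge incident to `S`. -/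
def removeIncident (G : SimpleGraph V) (S : Set V) : SimpleGraph V where
  Adj a b := G.Adj a b ∧ a ∉ S ∧ b ∉ S
  symm := ⟨fun _ _ ⟨h, ha, hb⟩ => ⟨h.symm, hb, ha⟩⟩
  loopless := ⟨fun a h => G.loopless.irrefl a h.1⟩

/-- The subgraph of `G` consisting of the edges incident to `S`. -/
def incidentSub (G : SimpleGraph V) (S : Set V) : SimpleGraph V where
  Adj a b := G.Adj a b ∧ (a ∈ S ∨ b ∈ S)
  symm := ⟨fun _ _ ⟨h, hs⟩ => ⟨h.symm, hs.symm⟩⟩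
  loopless := ⟨fun a h => G.loopless.irrefl a h.1⟩

/-- The vertex set of the connected component of `v` in `G`. -/
def compSet (G : SimpleGraph V) (v : V) : Set V := {u | G.Reachable u v}

/-- The family of vertex sets of the connected components of `G[S]` meeting `S`. -/
def compsOn (G : SimpleGraph V) (S : Set V) : Set (Set V) :=
  {K | ∃ v ∈ S, K = compSet (inducedOn G S) v}

/-- `G[S]` is factor-critical: for every `v ∈ S` there is a matching of `G[S]`
avoiding `v` and covering all other vertices of `S`. -/
def IsFactorCriticalOn (G : SimpleGraph V) (S : Set V) : Prop :=
  ∀ v ∈ S, ∃ M : Finset (Sym2 V), IsMatchingSet (inducedOn G S) M ∧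
    (∀ e ∈ M, v ∉ e) ∧ ∀ u ∈ S, u ≠ v → ∃ e ∈ M, u ∈ e

/-- The bipartite incidence graph of an indexed (multi)hypergraph. -/
def incGraph {ι : Type*} (E : ι → Set V) : SimpleGraph (V ⊕ ι) where
  Adj x y :=
    (∃ v i, x = Sum.inl v ∧ y = Sum.inr i ∧ v ∈ E i) ∨
    (∃ v i, x = Sum.inr i ∧ y = Sum.inl v ∧ v ∈ E i)
  symm := by
    constructor
    rintro x y (⟨v, i, rfl, rfl, h⟩ | ⟨v, i, rfl, rfl, h⟩)
    · exact Or.inr ⟨v, i, rfl, rfl, h⟩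
    · exact Or.inl ⟨v, i, rfl, rfl, h⟩
  loopless := by
    constructor
    rintro x (⟨v, i, rfl, h, -⟩ | ⟨v, i, rfl, h, -⟩) <;> simp at h

/-- An indexed (multi)hypergraph is a hyperforest if its incidence graph has no cycle. -/
def IsHyperforest {ι : Type*} (E : ι → Set V) : Prop := (incGraph E).IsAcyclic

/-- Index type of the multihypergraph `𝒞(𝒢)` of monochromatic connected components:
a colour together with the vertex set of a component of that colour graph. -/
def CompIdx {q : ℕ} (Gc : Fin q → SimpleGraph V) : Type _ :=
  Σ j : Fin q, {K : Set V // ∃ v : V, K = compSet (Gc j) v}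

/-- The hyperedges of the multihypergraph `𝒞(𝒢)`. -/
def CompEdge {q : ℕ} (Gc : Fin q → SimpleGraph V) : CompIdx Gc → Set V :=
  fun p => (p.2 : Set V)

/-- A coloured graph is acyclic if `𝒞(𝒢)` is a hyperforest. -/
def ColouringAcyclic {q : ℕ} (Gc : Fin q → SimpleGraph V) : Prop :=
  IsHyperforest (CompEdge Gc)

/-- `(G₀, G₁, …, G_q)` is a `q`-multicolouring of `G`: the union of all
(coloured and uncoloured) edge sets is the edge set of `G`. -/
def IsMulticolouring (G G0 : SimpleGraph V) {q : ℕ} (Gc : Fin q → SimpleGraph V) : Prop :=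
  G0 ⊔ (⨆ j, Gc j) = G

/-- The colouring `(G₀, G₁, …, G_q)` of `G` is `S`-proper: the uncoloured edges are
exactly the edges of `G` incident to `S`, and they carry no colour. -/
def IsSProper (G G0 : SimpleGraph V) {q : ℕ} (Gc : Fin q → SimpleGraph V) (S : Set V) : Prop :=
  G0.edgeSet = {e | e ∈ G.edgeSet ∧ ∃ v ∈ S, v ∈ e} ∧
    ∀ j, Disjoint G0.edgeSet (Gc j).edgeSet

/-- The potential `σ_𝒢(T) = r_𝒢(T) - |T|`, where
`r_𝒢(T) = ∑_j |A_j ∩ T| + ∑_j ∑_i (ν(G_j[K_j^i]) - ν(G_j[K_j^i ∖ T]))`,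
the inner sum running over the components `K_j^i` of `G_j[D_j]`. -/
noncomputable def sigmaCol {q : ℕ} (Gc : Fin q → SimpleGraph V) (T : Set V) : ℤ :=
  ((∑ j : Fin q, ((geA (Gc j) ∩ T).ncard : ℤ))
    + ∑ j : Fin q, ∑ᶠ K ∈ compsOn (Gc j) (geD (Gc j)),
        ((matchingNumber (inducedOn (Gc j) K) : ℤ)
          - (matchingNumber (inducedOn (Gc j) (K \ T)) : ℤ)))
    - (T.ncard : ℤ)

/-- `T` is `σ_𝒢`-maximal. -/
def SigmaMaximal {q : ℕ} (Gc : Fin q → SimpleGraph V) (T : Set V) : Prop :=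
  (∀ S : Set V, sigmaCol Gc S ≤ sigmaCol Gc T) ∧
    ∀ T' : Set V, T ⊂ T' → sigmaCol Gc T' < sigmaCol Gc T

/-- A matching of `G` encoded as an involution: matched vertices are swapped with their mates,
unmatched vertices are fixed. -/
def IsMatchingMap (G : SimpleGraph V) (f : V → V) : Prop :=
  Function.Involutive f ∧ ∀ v, f v ≠ v → G.Adj v (f v)

/-- The number of fixed points of `f`. -/
noncomputable def unmatchedCount (f : V → V) : ℕ :=
  (Function.fixedPoints f).ncard

/-- A matching map with the fewest unmatched vertices. -/
def IsMaxMatchingMap (G : SimpleGraph V) (f : V → V) : Prop :=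
  IsMatchingMap G f ∧ ∀ g, IsMatchingMap G g → unmatchedCount f ≤ unmatchedCount g

/-- The edge set `M` consists of the pairs `{v, f v}` with `f v ≠ v`. -/
def Represents (f : V → V) (M : Finset (Sym2 V)) : Prop :=
  ∀ v w, s(v, w) ∈ M ↔ v ≠ w ∧ f v = w

open Classical in
/-- Unmatch every vertex of `T`. -/
noncomputable def isolate (f : V → V) (T : Set V) (v : V) : V :=
  if v ∈ T ∨ f v ∈ T then v else f v

section Representation

variable {G : SimpleGraph V} {f : V → V} {M : Finset (Sym2 V)}

lemma IsMatchingSet.exists_represents (hM : IsMatchingSet G M) :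
    ∃ f, IsMatchingMap G f ∧ Represents f M := by
  classical
  have uniq : ∀ v w w', s(v, w) ∈ M → s(v, w') ∈ M → w = w' := by
    intro v w w' h h'
    by_contra hne
    exact hM.2 _ h _ h' (fun h => hne (Sym2.congr_right.mp h)) v (by simp) (by simp)
  have adj : ∀ v w, s(v, w) ∈ M → G.Adj v w := fun v w h => by simpa using hM.1 _ h
  let f : V → V := fun v => if h : ∃ w, s(v, w) ∈ M then h.choose else v
  have hf : ∀ v w, s(v, w) ∈ M → f v = w := by
    intro v w h
    have h' : ∃ w, s(v, w) ∈ M := ⟨w, h⟩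
    simp only [f, dif_pos h']
    exact uniq _ _ _ h'.choose_spec h
  have hf' : ∀ v, f v ≠ v → s(v, f v) ∈ M := by
    intro v h
    by_cases h' : ∃ w, s(v, w) ∈ M
    · simp only [f, dif_pos h']
      exact h'.choose_spec
    · simp [f, dif_neg h'] at h
  refine ⟨f, ⟨fun v => ?_, fun v h => adj _ _ (hf' v h)⟩, fun v w => ⟨fun h => ?_, ?_⟩⟩
  · by_cases h : f v = v
    · rw [h, h]
    · exact hf _ _ (Sym2.eq_swap ▸ hf' v h)
  · exact ⟨(adj _ _ h).ne, hf _ _ h⟩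
  · rintro ⟨h, rfl⟩
    exact hf' v h.symm

lemma IsMatchingMap.exists_represents [Fintype V] (hf : IsMatchingMap G f) :
    ∃ M, IsMatchingSet G M ∧ Represents f M := by
  classical
  let M : Finset (Sym2 V) :=
    Finset.univ.filter fun e => ∃ v, f v ≠ v ∧ e = s(v, f v)
  have hR : Represents f M := by
    intro v w
    simp only [M, Finset.mem_filter, Finset.mem_univ, true_and]
    constructor
    · rintro ⟨x, hx, h⟩
      rcases Sym2.eq_iff.mp h with ⟨rfl, rfl⟩ | ⟨rfl, rfl⟩
      · exact ⟨hx.symm, rfl⟩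
      · exact ⟨hx, hf.1 _⟩
    · rintro ⟨h, rfl⟩
      exact ⟨v, h.symm, rfl⟩
  refine ⟨M, ⟨?_, ?_⟩, hR⟩
  · intro e
    induction e with | _ v w
    intro h
    obtain ⟨hne, rfl⟩ := (hR v w).mp h
    simpa using hf.2 v hne.symm
  · intro e he e' he' hne v hv hv'
    obtain ⟨w, rfl⟩ := Sym2.mem_iff_exists.mp hv
    obtain ⟨w', rfl⟩ := Sym2.mem_iff_exists.mp hv'
    exact hne (by rw [← ((hR v w).mp he).2, ← ((hR v w').mp he').2])

open Classical in
lemma unmatchedCount_eq_sum [Fintype V] (f : V → V) :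
    unmatchedCount f = ∑ v, if f v = v then 1 else 0 := by
  rw [← Finset.card_filter, unmatchedCount, ← Set.ncard_coe_finset]
  congr 1
  ext v
  simp [Function.IsFixedPt]

lemma Represents.card_add [Fintype V] (hf : Function.Involutive f) (h : Represents f M) :
    2 * M.card + unmatchedCount f = Fintype.card V := by
  classical
  have hfix := unmatchedCount_eq_sum f
  rw [← Finset.card_filter] at hfix
  have hmap : ∀ v ∈ Finset.univ.filter (fun v => ¬ f v = v), s(v, f v) ∈ M := by
    intro v hv
    simp only [Finset.mem_filter, Finset.mem_univ, true_and] at hv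
    exact (h _ _).mpr ⟨fun h => hv h.symm, rfl⟩
  have hcard := Finset.card_eq_sum_card_fiberwise hmap
  rw [Finset.sum_congr rfl (g := fun _ => 2)] at hcard
  · have := Finset.card_filter_add_card_filter_not (s := (Finset.univ : Finset V))
      (fun v => f v = v)
    rw [Finset.sum_const, smul_eq_mul] at hcard
    rw [Finset.card_univ] at this
    omega
  · intro e
    induction e with | _ v w
    intro he
    obtain ⟨hne, rfl⟩ := (h v w).mp he
    rw [Finset.card_eq_two]
    refine ⟨v, f v, hne, ?_⟩
    ext x
    simp only [Finset.mem_filter, Finset.mem_univ, true_and, Finset.mem_insert,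
      Finset.mem_singleton, Sym2.eq_iff]
    constructor
    · rintro ⟨-, ⟨rfl, -⟩ | ⟨rfl, -⟩⟩ <;> simp
    · rintro (rfl | rfl)
      · exact ⟨hne.symm, Or.inl ⟨rfl, rfl⟩⟩
      · rw [hf v]
        exact ⟨hne, Or.inr ⟨rfl, rfl⟩⟩

lemma Represents.mem_iff (h : Represents f M) {e : Sym2 V} {v : V} (hv : v ∈ e) :
    e ∈ M ↔ f v ≠ v ∧ e = s(v, f v) := by
  obtain ⟨w, rfl⟩ := Sym2.mem_iff_exists.mp hv
  rw [h v w]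
  constructor
  · rintro ⟨hne, rfl⟩
    exact ⟨hne.symm, rfl⟩
  · rintro ⟨hne, he⟩
    have : w = f v := Sym2.congr_right.mp he
    exact ⟨fun h => hne (by rw [← this, ← h]), this.symm⟩

lemma Represents.not_covered_iff (h : Represents f M) (v : V) :
    (∀ e ∈ M, v ∉ e) ↔ f v = v := by
  constructor
  · intro hv
    by_contra hne
    exact hv s(v, f v) ((h _ _).mpr ⟨fun h => hne h.symm, rfl⟩) (by simp)
  · intro hv e he hve
    exact ((h.mem_iff hve).mp he).1 hv

lemma bddAbove_matching_card [Fintype V] (G : SimpleGraph V) :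
    BddAbove {n | ∃ M : Finset (Sym2 V), IsMatchingSet G M ∧ M.card = n} := by
  classical
  exact ⟨Fintype.card (Sym2 V), by rintro _ ⟨M, -, rfl⟩; exact M.card_le_univ⟩

lemma IsMatchingSet.card_le_matchingNumber [Fintype V] (hM : IsMatchingSet G M) :
    M.card ≤ matchingNumber G :=
  le_csSup (bddAbove_matching_card G) ⟨M, hM, rfl⟩

lemma exists_card_eq_matchingNumber [Fintype V] (G : SimpleGraph V) :
    ∃ M, IsMatchingSet G M ∧ M.card = matchingNumber G :=
  Nat.sSup_mem (s := {n | ∃ M : Finset (Sym2 V), IsMatchingSet G M ∧ M.card = n})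
    ⟨0, ∅, ⟨by simp, by simp⟩, rfl⟩ (bddAbove_matching_card G)

lemma Represents.isMaxMatchingMap_iff [Fintype V] (hf : IsMatchingMap G f)
    (hM : IsMatchingSet G M) (h : Represents f M) :
    IsMaxMatchingMap G f ↔ M.card = matchingNumber G := by
  have hc := h.card_add hf.1
  constructor
  · intro hmax
    obtain ⟨N, hN, hNc⟩ := exists_card_eq_matchingNumber G
    obtain ⟨g, hg, hgN⟩ := hN.exists_represents
    have := hmax.2 g hg
    have := hgN.card_add hg.1
    have := hM.card_le_matchingNumber
    omega
  · intro hmax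
    refine ⟨hf, fun g hg => ?_⟩
    obtain ⟨N, hN, hgN⟩ := hg.exists_represents
    have := hgN.card_add hg.1
    have := hN.card_le_matchingNumber
    omega

lemma exists_isMaxMatchingMap [Fintype V] (G : SimpleGraph V) : ∃ f, IsMaxMatchingMap G f := by
  obtain ⟨M, hM, hMc⟩ := exists_card_eq_matchingNumber G
  obtain ⟨f, hf, hfM⟩ := hM.exists_represents
  exact ⟨f, (hfM.isMaxMatchingMap_iff hf hM).mpr hMc⟩

lemma mem_geD_iff [Fintype V] {v : V} : v ∈ geD G ↔ ∃ f, IsMaxMatchingMap G f ∧ f v = v := by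
  constructor
  · rintro ⟨M, hM, hMc, hv⟩
    obtain ⟨f, hf, hfM⟩ := hM.exists_represents
    exact ⟨f, (hfM.isMaxMatchingMap_iff hf hM).mpr hMc, (hfM.not_covered_iff v).mp hv⟩
  · rintro ⟨f, hf, hv⟩
    obtain ⟨M, hM, hfM⟩ := hf.1.exists_represents
    exact ⟨M, hM, (hfM.isMaxMatchingMap_iff hf.1 hM).mp hf, (hfM.not_covered_iff v).mpr hv⟩

lemma IsMaxMatchingMap.apply_ne [Fintype V] (hf : IsMaxMatchingMap G f) {v : V}
    (hv : v ∉ geD G) : f v ≠ v :=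
  fun h => hv (mem_geD_iff.mpr ⟨f, hf, h⟩)

lemma IsMatchingMap.even_iff [Fintype V] (hf : IsMatchingMap G f) :
    Even (unmatchedCount f) ↔ Even (Fintype.card V) := by
  obtain ⟨M, -, hM⟩ := hf.exists_represents
  rw [← hM.card_add hf.1]
  simp [Nat.even_add]

lemma IsMatchingMap.mono {H : SimpleGraph V} (hf : IsMatchingMap G f) (h : G ≤ H) :
    IsMatchingMap H f :=
  ⟨hf.1, fun v hv => h (hf.2 v hv)⟩

lemma IsMaxMatchingMap.count_eq {g : V → V} (hf : IsMaxMatchingMap G f)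
    (hg : IsMaxMatchingMap G g) : unmatchedCount f = unmatchedCount g :=
  le_antisymm (hf.2 g hg.1) (hg.2 f hf.1)

end Representation

section Surgery

variable {G : SimpleGraph V} {f g : V → V}

/-- If `g` fixes `d`, the orbit of `d` under two involutions `f` and `g` contains at most one
fixed point of `f`. -/
lemma exists_invariant_set (hf : Function.Involutive f) (hg : Function.Involutive g) {d : V}
    (hd : g d = d) :
    ∃ O : Set V, d ∈ O ∧ (∀ x ∈ O, f x ∈ O) ∧ (∀ x ∈ O, g x ∈ O) ∧
      ∀ x ∈ O, ∀ y ∈ O, f x = x → f y = y → x = y := by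
  let F : Equiv.Perm V := hf.toPerm
  let K : Equiv.Perm V := hg.toPerm
  have hFF : F * F = 1 := by ext x; exact hf x
  have hKK : K * K = 1 := by ext x; exact hg x
  have hFi : F⁻¹ = F := inv_eq_of_mul_eq_one_left hFF
  have hKi : K⁻¹ = K := inv_eq_of_mul_eq_one_left hKK
  let σ : Equiv.Perm V := K * F
  have hσi : σ⁻¹ = F * K := by simp only [σ, mul_inv_rev, hFi, hKi]
  have hFσ : SemiconjBy F σ σ⁻¹ := by
    rw [SemiconjBy, hσi, mul_assoc]
  have hKσ : SemiconjBy K σ σ⁻¹ := by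
    rw [SemiconjBy, hσi, mul_assoc, hKK, ← mul_assoc, hKK]; simp
  have hKk : ∀ k : ℤ, g ((σ ^ k) d) = (σ ^ (-k)) d := by
    intro k
    have := congrArg (fun τ : Equiv.Perm V => τ d) (hKσ.zpow_right k).eq
    simp only [Equiv.Perm.mul_apply, inv_zpow, ← zpow_neg] at this
    rw [show K d = d from hd] at this
    exact this
  have hFk : ∀ k : ℤ, f ((σ ^ k) d) = (σ ^ (-k - 1)) d := by
    intro k
    have := congrArg (fun τ : Equiv.Perm V => τ d) (hFσ.zpow_right k).eq
    simp only [Equiv.Perm.mul_apply, inv_zpow, ← zpow_neg] at this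
    have h1 : F d = (σ⁻¹) d := by
      rw [hσi, Equiv.Perm.mul_apply, show K d = d from hd]
    rw [zpow_sub_one, Equiv.Perm.mul_apply, ← h1]
    exact this
  refine ⟨{x | ∃ k : ℤ, x = (σ ^ k) d}, ⟨0, by simp⟩, ?_, ?_, ?_⟩
  · rintro _ ⟨k, rfl⟩
    exact ⟨_, hFk k⟩
  · rintro _ ⟨k, rfl⟩
    exact ⟨_, hKk k⟩
  · rintro _ ⟨k, rfl⟩ _ ⟨l, rfl⟩ hk hl
    let S : Subgroup (Equiv.Perm V) := MulAction.stabilizer (Equiv.Perm V) d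
    have hS : ∀ m n : ℤ, (σ ^ m) d = (σ ^ n) d ↔ σ ^ (m - n) ∈ S := by
      intro m n
      rw [MulAction.mem_stabilizer_iff, Equiv.Perm.smul_def, sub_eq_neg_add, zpow_add,
        Equiv.Perm.mul_apply, zpow_neg, Equiv.Perm.inv_eq_iff_eq]
    rw [hFk, hS] at hk hl
    rw [hS]
    have h := S.mul_mem (S.zpow_mem hk l) (S.zpow_mem hl (-k))
    rw [← zpow_mul, ← zpow_mul, ← zpow_add] at h
    convert h using 1
    congr 1
    ring

open Classical in
lemma IsMatchingMap.piecewise (hf : IsMatchingMap G f) (hg : IsMatchingMap G g) {O : Set V}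
    (hfO : ∀ x ∈ O, f x ∈ O) (hgO : ∀ x ∈ O, g x ∈ O) : IsMatchingMap G (O.piecewise g f) := by
  have hfO' : ∀ x ∉ O, f x ∉ O := fun x hx h => hx (hf.1 x ▸ hfO _ h)
  refine ⟨fun v => ?_, fun v => ?_⟩
  · by_cases hv : v ∈ O
    · rw [Set.piecewise_eq_of_mem _ _ _ hv, Set.piecewise_eq_of_mem _ _ _ (hgO v hv), hg.1]
    · rw [Set.piecewise_eq_of_notMem _ _ _ hv, Set.piecewise_eq_of_notMem _ _ _ (hfO' v hv), hf.1]
  · by_cases hv : v ∈ O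
    · rw [Set.piecewise_eq_of_mem _ _ _ hv]
      exact hg.2 v
    · rw [Set.piecewise_eq_of_notMem _ _ _ hv]
      exact hf.2 v

open Classical in
lemma unmatchedCount_piecewise_add [Fintype V] (f g : V → V) (O : Set V) :
    unmatchedCount (O.piecewise g f) + unmatchedCount (O.piecewise f g) =
      unmatchedCount f + unmatchedCount g := by
  simp only [unmatchedCount_eq_sum, ← Finset.sum_add_distrib]
  refine Finset.sum_congr rfl fun v _ => ?_
  by_cases hv : v ∈ O
  · simp [Set.piecewise_eq_of_mem _ _ _ hv, add_comm]
  · simp [Set.piecewise_eq_of_notMem _ _ _ hv]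

lemma IsMatchingMap.exists_add_edge [Fintype V] (hf : IsMatchingMap G f) {a d : V}
    (had : G.Adj a d) (ha : f a = a) (hd : f d = d) :
    ∃ h, IsMatchingMap G h ∧ unmatchedCount h + 2 ≤ unmatchedCount f ∧
      ∀ v, v ≠ a → v ≠ d → f v = v → h v = v := by
  classical
  have hne := had.ne
  have hfa : ∀ v, v ≠ a → f v ≠ a := fun v hv h => hv (by rw [← hf.1 v, h, ha])
  have hfd : ∀ v, v ≠ d → f v ≠ d := fun v hv h => hv (by rw [← hf.1 v, h, hd])
  let h : V → V := fun v => Equiv.swap a d (f v)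
  have h_a : h a = d := by simp [h, ha]
  have h_d : h d = a := by simp [h, hd]
  have h_v : ∀ v, v ≠ a → v ≠ d → h v = f v := fun v hva hvd =>
    Equiv.swap_apply_of_ne_of_ne (hfa v hva) (hfd v hvd)
  refine ⟨h, ⟨fun v => ?_, fun v hv => ?_⟩, ?_, fun v hva hvd hv => (h_v v hva hvd).trans hv⟩
  · by_cases hva : v = a
    · rw [hva, h_a, h_d]
    by_cases hvd : v = d
    · rw [hvd, h_d, h_a]
    rw [h_v v hva hvd, h_v _ (hfa v hva) (hfd v hvd), hf.1]
  · by_cases hva : v = a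
    · rw [hva, h_a]; exact had
    by_cases hvd : v = d
    · rw [hvd, h_d]; exact had.symm
    rw [h_v v hva hvd] at hv ⊢
    exact hf.2 v hv
  · have hsub : Function.fixedPoints h ⊆ Function.fixedPoints f \ {a, d} := by
      intro v hv
      rw [Function.mem_fixedPoints_iff] at hv
      have hva : v ≠ a := by rintro rfl; exact hne (hv.symm.trans h_a)
      have hvd : v ≠ d := by rintro rfl; exact hne (h_d.symm.trans hv)
      refine ⟨(h_v v hva hvd).symm.trans hv, by simp [hva, hvd]⟩
    have hle := Set.ncard_le_ncard hsub
    have hpair : ({a, d} : Set V) ⊆ Function.fixedPoints f := by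
      rintro v (rfl | rfl)
      exacts [ha, hd]
    have := Set.ncard_sdiff_add_ncard_of_subset hpair
    rw [Set.ncard_pair hne] at this
    unfold unmatchedCount
    omega

lemma isolate_of_mem {T : Set V} {v : V} (h : v ∈ T ∨ f v ∈ T) : isolate f T v = v :=
  if_pos h

lemma isolate_of_notMem {T : Set V} {v : V} (h : ¬ (v ∈ T ∨ f v ∈ T)) : isolate f T v = f v :=
  if_neg h

lemma isolate_eq_self_iff {T : Set V} {v : V} :
    isolate f T v = v ↔ v ∈ T ∨ f v ∈ T ∨ f v = v := by
  by_cases h : v ∈ T ∨ f v ∈ T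
  · simp only [isolate_of_mem h, true_iff]
    tauto
  · rw [isolate_of_notMem h]
    tauto

lemma IsMatchingMap.isolate (hf : IsMatchingMap G f) (T : Set V) :
    IsMatchingMap (removeIncident G T) (isolate f T) := by
  refine ⟨fun v => ?_, fun v hv => ?_⟩
  · by_cases h : v ∈ T ∨ f v ∈ T
    · rw [isolate_of_mem h, isolate_of_mem h]
    · rw [isolate_of_notMem h, isolate_of_notMem (by rwa [hf.1, or_comm]), hf.1]
  · have h : ¬ (v ∈ T ∨ f v ∈ T) := fun h => hv (isolate_of_mem h)
    rw [isolate_of_notMem h] at hv ⊢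
    rw [not_or] at h
    exact ⟨hf.2 v hv, h⟩

lemma unmatchedCount_isolate_le [Fintype V] (f : V → V) (hf : Function.Involutive f) (T : Set V) :
    unmatchedCount (isolate f T) ≤ unmatchedCount f + 2 * T.ncard := by
  have hsub : Function.fixedPoints (isolate f T) ⊆ Function.fixedPoints f ∪ (T ∪ f '' T) := by
    intro v hv
    rcases isolate_eq_self_iff.mp hv with h | h | h
    · exact Or.inr (Or.inl h)
    · exact Or.inr (Or.inr ⟨_, h, hf v⟩)
    · exact Or.inl h
  have h1 := Set.ncard_le_ncard hsub
  have h2 := Set.ncard_union_le (Function.fixedPoints f) (T ∪ f '' T)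
  have h3 := Set.ncard_union_le T (f '' T)
  have h4 := Set.ncard_image_le (f := f) T.toFinite
  unfold unmatchedCount
  omega

lemma removeIncident_le (G : SimpleGraph V) (T : Set V) : removeIncident G T ≤ G :=
  fun _ _ h => h.1

lemma IsMatchingMap.eq_self_of_removeIncident {T : Set V}
    (hf : IsMatchingMap (removeIncident G T) f) {v : V} (hv : v ∈ T) : f v = v := by
  by_contra h
  exact (hf.2 v h).2.1 hv

lemma removeIncident_insert (G : SimpleGraph V) (T : Set V) (a : V) :
    removeIncident (removeIncident G T) {a} = removeIncident G (insert a T) := by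
  ext x y
  simp only [removeIncident, Set.mem_singleton_iff, Set.mem_insert_iff]
  tauto

lemma removeIncident_empty (G : SimpleGraph V) : removeIncident G ∅ = G := by
  ext x y
  simp [removeIncident]

lemma mem_geD_of_mem_compSet {u v : V} (hv : v ∈ geD G)
    (hu : u ∈ compSet (inducedOn G (geD G)) v) : u ∈ geD G := by
  obtain ⟨p⟩ := hu
  cases p with
  | nil => exact hv
  | cons h _ => exact h.2.1

lemma Represents.forall_notMem_iff_isolate {M : Finset (Sym2 V)}
    (h : Represents f M) {K : Set V} {u : V} (hu : u ∈ K) :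
    (∀ e ∈ M, (∀ w ∈ e, w ∈ K) → u ∉ e) ↔ isolate f Kᶜ u = u := by
  rw [isolate_eq_self_iff]
  constructor
  · intro hno
    by_contra! hcon
    refine hno s(u, f u) ((h _ _).mpr ⟨hcon.2.2.symm, rfl⟩) ?_ (by simp)
    intro w hw
    rcases Sym2.mem_iff.mp hw with rfl | rfl
    exacts [hu, not_not.mp hcon.2.1]
  · intro hiso e he heK hue
    obtain ⟨hne, rfl⟩ := (h.mem_iff hue).mp he
    rcases hiso with h | h | h
    exacts [h hu, h (heK _ (by simp)), hne h]

/-- A vertex of a component of `G[D]` is not matched inside the component iff it is unmatched or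
matched to `A`. -/
lemma IsMaxMatchingMap.isolate_compl_eq_self_iff (hf : IsMaxMatchingMap G f) {u v : V}
    (hv : v ∈ geD G) (hu : u ∈ compSet (inducedOn G (geD G)) v) :
    isolate f (compSet (inducedOn G (geD G)) v)ᶜ u = u ↔ f u ∈ geA G ∨ f u = u := by
  have huD := mem_geD_of_mem_compSet hv hu
  rw [isolate_eq_self_iff]
  constructor
  · rintro (h | h | h)
    · exact absurd hu h
    · by_cases hfu : f u = u
      · exact Or.inr hfu
      have hadj := hf.1.2 u hfu
      by_cases hfD : f u ∈ geD G
      · have : (inducedOn G (geD G)).Adj (f u) u := ⟨hadj.symm, hfD, huD⟩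
        exact absurd (this.reachable.trans hu) h
      · exact Or.inl ⟨hfD, u, huD, hadj.symm⟩
    · exact Or.inr h
  · rintro (h | h)
    · exact Or.inr (Or.inl fun h' => h.1 (mem_geD_of_mem_compSet hv h'))
    · exact Or.inr (Or.inr h)

end Surgery

section Stability

variable [Fintype V] {G : SimpleGraph V} {f g : V → V}

lemma IsMaxMatchingMap.add_two_le (hf : IsMaxMatchingMap G f) (hg : IsMatchingMap G g) {a : V}
    (ha : a ∉ geD G) (hga : g a = a) : unmatchedCount f + 2 ≤ unmatchedCount g := by
  have hle := hf.2 g hg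
  have hne : unmatchedCount g ≠ unmatchedCount f := fun h =>
    ha (mem_geD_iff.mpr ⟨g, ⟨hg, h ▸ hf.2⟩, hga⟩)
  have hpar := hf.1.even_iff.trans hg.even_iff.symm
  have hne' : unmatchedCount g ≠ unmatchedCount f + 1 := by
    intro h
    rw [h, Nat.even_add_one] at hpar
    tauto
  omega

/-- A matching missing `a ∈ A` that is optimal among those misses, besides `a`, only
inessential vertices. -/
lemma mem_geD_of_count_le (hf : IsMaxMatchingMap G f) {a v : V} (ha : a ∈ geA G)
    (hg : IsMatchingMap G g) (hga : g a = a) (hgv : g v = v) (hva : v ≠ a)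
    (hgf : unmatchedCount g ≤ unmatchedCount f + 2) : v ∈ geD G := by
  classical
  obtain ⟨haD, d, hd, had⟩ := ha
  obtain ⟨k, hk, hkd⟩ := mem_geD_iff.mp hd
  rw [hf.count_eq hk] at hgf
  by_cases hvd : v = d
  · rwa [hvd]
  obtain ⟨O, hdO, hgO, hkO, huniq⟩ := exists_invariant_set hg.1 hk.1.1 hkd
  have h₁ := hk.1.piecewise hg hkO hgO
  have h₂ := hg.piecewise hk.1 hgO hkO
  have hsum := unmatchedCount_piecewise_add k g O
  have le₁ := hk.2 _ h₁
  have of_le : ∀ h, IsMatchingMap G h → h v = v → unmatchedCount h ≤ unmatchedCount k →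
      v ∈ geD G := fun h hh hv hle =>
    mem_geD_iff.mpr ⟨h, ⟨hh, fun j hj => hle.trans (hk.2 j hj)⟩, hv⟩
  by_cases haO : a ∈ O
  · have hvO : v ∉ O := fun hvO => hva (huniq v hvO a haO hgv hga)
    have := hk.add_two_le h₁ haD (by rwa [Set.piecewise_eq_of_mem _ _ _ haO])
    exact of_le _ h₂ (by rwa [Set.piecewise_eq_of_notMem _ _ _ hvO]) (by omega)
  · obtain ⟨h₃, hh₃, hcount, hfix⟩ := h₂.exists_add_edge had
      (by rwa [Set.piecewise_eq_of_notMem _ _ _ haO]) (by rwa [Set.piecewise_eq_of_mem _ _ _ hdO])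
    have le₃ := hk.2 _ hh₃
    by_cases hvO : v ∈ O
    · exact of_le _ h₁ (by rwa [Set.piecewise_eq_of_mem _ _ _ hvO]) (by omega)
    · exact of_le _ hh₃ (hfix v hva hvd (by rwa [Set.piecewise_eq_of_notMem _ _ _ hvO]))
        (by omega)

lemma IsMaxMatchingMap.isolate_singleton (hf : IsMaxMatchingMap G f) {a : V} (ha : a ∉ geD G) :
    IsMaxMatchingMap (removeIncident G {a}) (isolate f {a}) ∧
      unmatchedCount (isolate f {a}) = unmatchedCount f + 2 := by
  have hle := unmatchedCount_isolate_le f hf.1.1 {a}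
  rw [Set.ncard_singleton] at hle
  have hge : ∀ g, IsMatchingMap (removeIncident G {a}) g →
      unmatchedCount f + 2 ≤ unmatchedCount g := fun g hg =>
    hf.add_two_le (hg.mono (removeIncident_le _ _)) ha (hg.eq_self_of_removeIncident rfl)
  have hiso := hf.1.isolate {a}
  exact ⟨⟨hiso, fun g hg => hle.trans (hge g hg)⟩, le_antisymm hle (hge _ hiso)⟩

lemma geD_removeIncident_singleton {a : V} (ha : a ∈ geA G) :
    geD (removeIncident G {a}) = insert a (geD G) := by
  ext v
  constructor
  · intro hv
    obtain ⟨g, hg, hgv⟩ := mem_geD_iff.mp hv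
    obtain ⟨f, hf⟩ := exists_isMaxMatchingMap G
    obtain ⟨hf', hcount⟩ := hf.isolate_singleton ha.1
    by_cases hva : v = a
    · exact Or.inl hva
    · exact Or.inr (mem_geD_of_count_le hf ha (hg.1.mono (removeIncident_le _ _))
        (hg.1.eq_self_of_removeIncident rfl) hgv hva ((hg.count_eq hf').trans hcount).le)
  · intro hv
    obtain ⟨f, hf, hfv⟩ : ∃ f, IsMaxMatchingMap G f ∧ (v = a ∨ f v = v) := by
      rcases hv with rfl | hv
      · obtain ⟨f, hf⟩ := exists_isMaxMatchingMap G
        exact ⟨f, hf, Or.inl rfl⟩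
      · obtain ⟨f, hf, hfv⟩ := mem_geD_iff.mp hv
        exact ⟨f, hf, Or.inr hfv⟩
    refine mem_geD_iff.mpr ⟨_, (hf.isolate_singleton ha.1).1, isolate_eq_self_iff.mpr ?_⟩
    rcases hfv with h | h
    · exact Or.inl h
    · exact Or.inr (Or.inr h)

/-- Deleting part of `A` keeps the inessential vertices and raises the deficiency by one per
deleted vertex; the deleted vertices remain as isolated vertices. -/
lemma removeIncident_subset_geA (T : Set V) (hT : T ⊆ geA G) :
    geD (removeIncident G T) = geD G ∪ T ∧
      ∀ f g, IsMaxMatchingMap G f → IsMaxMatchingMap (removeIncident G T) g →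
        unmatchedCount g = unmatchedCount f + 2 * T.ncard := by
  induction T, T.toFinite using Set.Finite.induction_on with
  | empty =>
    simp only [removeIncident_empty, Set.union_empty, Set.ncard_empty, true_and]
    exact fun f g hf hg => hg.count_eq hf
  | @insert a T haT hTfin ih =>
    obtain ⟨ihD, ihc⟩ := ih ((Set.subset_insert _ _).trans hT)
    obtain ⟨haD, d, hd, had⟩ := hT (Set.mem_insert a T)
    have hdT : d ∉ T := fun h => (hT (Set.mem_insert_of_mem _ h)).1 hd
    have ha : a ∈ geA (removeIncident G T) := by
      refine ⟨by rw [ihD]; rintro (h | h); exacts [haD h, haT h], d, by rw [ihD]; exact Or.inl hd,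
        had, haT, hdT⟩
    rw [← removeIncident_insert]
    refine ⟨by rw [geD_removeIncident_singleton ha, ihD, Set.union_insert], fun f g hf hg => ?_⟩
    obtain ⟨k, hk⟩ := exists_isMaxMatchingMap (removeIncident G T)
    obtain ⟨hk', hcount⟩ := hk.isolate_singleton ha.1
    rw [hg.count_eq hk', hcount, ihc f k hf hk, Set.ncard_insert_of_notMem haT hTfin]
    ring

lemma IsMaxMatchingMap.isolate_geA (hf : IsMaxMatchingMap G f) :
    IsMaxMatchingMap (removeIncident G (geA G)) (isolate f (geA G)) := by
  refine ⟨hf.1.isolate _, fun g hg => ?_⟩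
  obtain ⟨k, hk⟩ := exists_isMaxMatchingMap (removeIncident G (geA G))
  calc unmatchedCount (isolate f (geA G)) ≤ unmatchedCount f + 2 * (geA G).ncard :=
        unmatchedCount_isolate_le f hf.1.1 _
    _ = unmatchedCount k := ((removeIncident_subset_geA _ subset_rfl).2 f k hf hk).symm
    _ ≤ unmatchedCount g := hk.2 g hg

/-- **Gallai's lemma**: a maximum matching misses at most one vertex of each component of
`G[D]`. -/
lemma IsMaxMatchingMap.eq_of_reachable {u w : V} (h : (inducedOn G (geD G)).Reachable u w)
    (hf : IsMaxMatchingMap G f) (hu : f u = u) (hw : f w = w) : u = w := by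
  classical
  obtain ⟨p⟩ := h
  induction p generalizing f with
  | nil => rfl
  | @cons u v w huv p ih =>
    have huv' : ∀ k, IsMaxMatchingMap G k → k u = u → k v ≠ v := by
      intro k hk hku hkv
      obtain ⟨j, hj, hcount, -⟩ := hk.1.exists_add_edge huv.1 hku hkv
      have := hk.2 j hj
      omega
    by_contra hne
    obtain ⟨g, hg, hgv⟩ := mem_geD_iff.mp huv.2.2
    obtain ⟨O, hvO, hfO, hgO, huniq⟩ := exists_invariant_set hf.1.1 hg.1.1 hgv
    have h₁ := hf.1.piecewise hg.1 hfO hgO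
    have h₂ := hg.1.piecewise hf.1 hgO hfO
    have hmax : IsMaxMatchingMap G (O.piecewise g f) := by
      refine ⟨h₁, fun k hk => ?_⟩
      have := unmatchedCount_piecewise_add f g O
      have := hg.2 _ h₂
      have := hf.2 k hk
      omega
    have hv : O.piecewise g f v = v := by rwa [Set.piecewise_eq_of_mem _ _ _ hvO]
    by_cases huO : u ∈ O
    · have hwO : w ∉ O := fun hwO => hne (huniq u huO w hwO hu hw)
      have hvw := ih hmax hv (by rwa [Set.piecewise_eq_of_notMem _ _ _ hwO])
      exact hwO (hvw ▸ hvO)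
    · exact huv' _ hmax (by rwa [Set.piecewise_eq_of_notMem _ _ _ huO]) hv

end Stability

section Structure

variable [Fintype V] {G : SimpleGraph V} {f : V → V}

lemma IsMaxMatchingMap.apply_mem_geD (hf : IsMaxMatchingMap G f) {a : V} (ha : a ∈ geA G) :
    f a ∈ geD G := by
  have h : f a ∈ geD (removeIncident G {a}) :=
    mem_geD_iff.mpr ⟨_, (hf.isolate_singleton ha.1).1,
      isolate_of_mem (Or.inr (hf.1.1 a))⟩
  rw [geD_removeIncident_singleton ha] at h
  exact h.resolve_left (hf.apply_ne ha.1)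

lemma IsMaxMatchingMap.apply_mem_geC (hf : IsMaxMatchingMap G f) {c : V} (hc : c ∈ geC G) :
    f c ∈ geC G := by
  have hadj := hf.1.2 c (hf.apply_ne hc.1)
  refine ⟨fun h => hc.2 ⟨hc.1, _, h, hadj⟩, fun h => hc.1 ?_⟩
  simpa only [hf.1.1 c] using hf.apply_mem_geD h

/-- Each component of `G[D]` has at most one vertex that a maximum matching leaves unmatched or
matches to `A`. -/
lemma IsMaxMatchingMap.eq_of_exposed (hf : IsMaxMatchingMap G f) {u w : V}
    (h : (inducedOn G (geD G)).Reachable u w) (hu : f u ∈ geA G ∨ f u = u)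
    (hw : f w ∈ geA G ∨ f w = w) : u = w := by
  have hD : geD (removeIncident G (geA G)) = geD G ∪ geA G :=
    (removeIncident_subset_geA _ subset_rfl).1
  refine hf.isolate_geA.eq_of_reachable (h.mono ?_) (isolate_eq_self_iff.mpr (Or.inr hu))
    (isolate_eq_self_iff.mpr (Or.inr hw))
  rintro x y ⟨hxy, hx, hy⟩
  rw [hD]
  exact ⟨⟨hxy, fun h => h.1 hx, fun h => h.1 hy⟩, Or.inl hx, Or.inl hy⟩

lemma isFactorCriticalOn_compSet {v : V} (hv : v ∈ geD G) :
    IsFactorCriticalOn G (compSet (inducedOn G (geD G)) v) := by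
  intro u hu
  obtain ⟨f, hf, hfu⟩ := mem_geD_iff.mp (mem_geD_of_mem_compSet hv hu)
  set K := compSet (inducedOn G (geD G)) v
  have hmap : IsMatchingMap (inducedOn G K) (isolate f Kᶜ) := by
    refine (hf.1.isolate Kᶜ).mono ?_
    rintro x y ⟨hxy, hx, hy⟩
    exact ⟨hxy, not_not.mp hx, not_not.mp hy⟩
  obtain ⟨M, hM, hfM⟩ := hmap.exists_represents
  refine ⟨M, hM, (hfM.not_covered_iff u).mpr (isolate_eq_self_iff.mpr (Or.inr (Or.inr hfu))),
    fun w hw hwu => ?_⟩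
  by_contra! h
  have hexp := (hf.isolate_compl_eq_self_iff hv hw).mp ((hfM.not_covered_iff w).mp h)
  exact hwu (hf.eq_of_exposed (Reachable.trans hw hu.symm) hexp (Or.inr hfu))

/-- Each component of `G[D]` has an exposed vertex with respect to every maximum matching. -/
lemma IsMaxMatchingMap.exists_exposed (hf : IsMaxMatchingMap G f) {v : V} (hv : v ∈ geD G) :
    ∃ u ∈ compSet (inducedOn G (geD G)) v, f u ∈ geA G ∨ f u = u := by
  by_contra! hno
  obtain ⟨g, hg, hgv⟩ := mem_geD_iff.mp hv
  have hvK : v ∈ compSet (inducedOn G (geD G)) v := Reachable.refl v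
  have hfixf : Function.fixedPoints (isolate f (compSet (inducedOn G (geD G)) v)ᶜ) =
      (compSet (inducedOn G (geD G)) v)ᶜ := by
    ext u
    rw [Function.mem_fixedPoints_iff]
    refine ⟨fun h hu => ?_, fun h => isolate_of_mem (Or.inl h)⟩
    have := hno u hu
    rcases (hf.isolate_compl_eq_self_iff hv hu).mp h with h | h
    exacts [this.1 h, this.2 h]
  have hfixg : Function.fixedPoints (isolate g (compSet (inducedOn G (geD G)) v)ᶜ) =
      insert v (compSet (inducedOn G (geD G)) v)ᶜ := by
    ext u
    rw [Function.mem_fixedPoints_iff]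
    constructor
    · intro h
      by_cases hu : u ∈ compSet (inducedOn G (geD G)) v
      · exact Or.inl (hg.eq_of_exposed hu ((hg.isolate_compl_eq_self_iff hv hu).mp h)
          (Or.inr hgv))
      · exact Or.inr hu
    · rintro (rfl | h)
      · exact isolate_eq_self_iff.mpr (Or.inr (Or.inr hgv))
      · exact isolate_of_mem (Or.inl h)
  have hpar := (hf.1.isolate (compSet (inducedOn G (geD G)) v)ᶜ).even_iff.trans
    (hg.1.isolate (compSet (inducedOn G (geD G)) v)ᶜ).even_iff.symm
  rw [unmatchedCount, unmatchedCount, hfixf, hfixg,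
    Set.ncard_insert_of_notMem (Set.notMem_compl_iff.mpr hvK), Nat.even_add_one] at hpar
  tauto

lemma IsMaxMatchingMap.ncard_compsOn (hf : IsMaxMatchingMap G f) :
    (compsOn G (geD G)).ncard = unmatchedCount f + (geA G).ncard := by
  have himage : compsOn G (geD G) =
      compSet (inducedOn G (geD G)) '' (Function.fixedPoints f ∪ f '' geA G) := by
    ext K
    constructor
    · rintro ⟨v, hv, rfl⟩
      obtain ⟨u, hu, hexp⟩ := hf.exists_exposed hv
      refine ⟨u, hexp.symm.imp id fun h => ⟨_, h, hf.1.1 u⟩, ?_⟩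
      ext x
      exact ⟨fun h => Reachable.trans h hu, fun h => Reachable.trans h hu.symm⟩
    · rintro ⟨u, hu, rfl⟩
      refine ⟨u, ?_, rfl⟩
      rcases hu with hu | ⟨a, ha, rfl⟩
      · exact mem_geD_iff.mpr ⟨f, hf, hu⟩
      · exact hf.apply_mem_geD ha
  have hexp : ∀ u ∈ Function.fixedPoints f ∪ f '' geA G, f u ∈ geA G ∨ f u = u := by
    rintro u (hu | ⟨a, ha, rfl⟩)
    · exact Or.inr hu
    · exact Or.inl (by rwa [hf.1.1 a])
  have hinj : Set.InjOn (compSet (inducedOn G (geD G)))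
      (Function.fixedPoints f ∪ f '' geA G) := by
    intro u hu w hw huw
    have : u ∈ compSet (inducedOn G (geD G)) w := huw ▸ Reachable.refl u
    exact hf.eq_of_exposed this (hexp u hu) (hexp w hw)
  have hdisj : Disjoint (Function.fixedPoints f) (f '' geA G) := by
    rw [Set.disjoint_right]
    rintro _ ⟨a, ha, rfl⟩ h
    exact hf.apply_ne ha.1 (hf.1.1.injective h)
  rw [himage, hinj.ncard_image, Set.ncard_union_eq hdisj,
    Set.ncard_image_of_injective _ hf.1.1.injective, unmatchedCount]

end Structure

/-- **Gallai–Edmonds Structure Theorem.** Let `GE(G) = (C, A, D)`. Then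
(1) every connected component of `G[D]` is factor-critical;
(2) every maximum matching `M` of `G` contains a perfect matching of `G[C]`, contains a
near-perfect matching of each component of `G[D]` (exactly one vertex of each component
is left uncovered by the edges of `M` inside that component), and matches every vertex of
`A` to vertices lying in pairwise distinct components of `G[D]`;
(3) `|V| - 2ν(G) = k(D) - |A|`. -/
theorem gallai_edmonds_structure {V : Type*} [Fintype V] (G : SimpleGraph V) :
    (∀ v ∈ geD G, IsFactorCriticalOn G (compSet (inducedOn G (geD G)) v)) ∧
    (∀ M : Finset (Sym2 V), IsMatchingSet G M → M.card = matchingNumber G →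
      ((∀ v ∈ geC G, ∃ e ∈ M, v ∈ e ∧ ∀ u ∈ e, u ∈ geC G) ∧
        (∀ v ∈ geD G, ∃! u, u ∈ compSet (inducedOn G (geD G)) v ∧
          ∀ e ∈ M, (∀ w ∈ e, w ∈ compSet (inducedOn G (geD G)) v) → u ∉ e) ∧
        (∃ f : V → V, (∀ a ∈ geA G, f a ∈ geD G ∧ s(a, f a) ∈ M) ∧
          ∀ a ∈ geA G, ∀ a' ∈ geA G, a ≠ a' →
            ¬ (inducedOn G (geD G)).Reachable (f a) (f a')))) ∧
    ((Fintype.card V : ℤ) - 2 * (matchingNumber G : ℤ)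
      = ((compsOn G (geD G)).ncard : ℤ) - ((geA G).ncard : ℤ)) := by
  refine ⟨fun v hv => isFactorCriticalOn_compSet hv, fun M hM hMc => ?_, ?_⟩
  · obtain ⟨f, hf, hfM⟩ := hM.exists_represents
    have hmax := (hfM.isMaxMatchingMap_iff hf hM).mpr hMc
    refine ⟨fun c hc => ?_, fun v hv => ?_, f, fun a ha => ?_, fun a ha a' ha' hne hreach => ?_⟩
    · refine ⟨s(c, f c), (hfM _ _).mpr ⟨(hmax.apply_ne hc.1).symm, rfl⟩, by simp, ?_⟩
      intro u hu
      rcases Sym2.mem_iff.mp hu with rfl | rfl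
      exacts [hc, hmax.apply_mem_geC hc]
    · obtain ⟨u, hu, hexp⟩ := hmax.exists_exposed hv
      refine ⟨u, ⟨hu, (hfM.forall_notMem_iff_isolate hu).mpr
        ((hmax.isolate_compl_eq_self_iff hv hu).mpr hexp)⟩, ?_⟩
      rintro w ⟨hw, hwM⟩
      exact hmax.eq_of_exposed (Reachable.trans hw hu.symm)
        ((hmax.isolate_compl_eq_self_iff hv hw).mp
          ((hfM.forall_notMem_iff_isolate hw).mp hwM)) hexp
    · exact ⟨hmax.apply_mem_geD ha, (hfM _ _).mpr ⟨(hmax.apply_ne ha.1).symm, rfl⟩⟩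
    · exact hne (hf.1.injective (hmax.eq_of_exposed hreach (Or.inl (by rwa [hf.1 a]))
        (Or.inl (by rwa [hf.1 a']))))
  · obtain ⟨M, hM, hMc⟩ := exists_card_eq_matchingNumber G
    obtain ⟨f, hf, hfM⟩ := hM.exists_represents
    have hcomps := ((hfM.isMaxMatchingMap_iff hf hM).mpr hMc).ncard_compsOn
    have hcard := hfM.card_add hf.1
    omega
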